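/- arXiv:2309.05425 — 2 statements merged into one kernel-verified Lean document; each statement's English description precedes it below -/
import Mathlib

section
/- With f_1, f_2 as above, ‖f_1^{(r,0)} − f_2^{(r,0)}‖_{L_2} ≥ (c̃/(2^{3r−2}(r−1)!))·N^{−μ₁+2r−1/s+1/2}. -/
open Finset

/-- The orthonormal Legendre polynomial on `[-1,1]`. -/
noncomputable def legP (k : ℕ) : ℝ → ℝ := fun t =>
  Real.sqrt ((k : ℝ) + 1 / 2) * ((2 ^ k * (Nat.factorial k : ℝ))⁻¹) *
    iteratedDeriv k (fun x : ℝ => (x ^ 2 - 1) ^ k) t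

/-- `f₁^{(r,0)} - f₂^{(r,0)} = c̃ N^{-μ₁-1/s} φ₁(τ) Σ'_{k∈S} φ_k^{(r)}(t)`. -/
noncomputable def gDiff (ctil : ℝ) (N : ℕ) (μ₁ s : ℝ) (S : Finset ℕ) (r : ℕ)
    (t τ : ℝ) : ℝ :=
  ctil * (N : ℝ) ^ (-μ₁ - 1 / s) * legP 1 τ * ∑ k ∈ S, iteratedDeriv r (legP k) t

section LegendrePolynomials

open Polynomial

/-- If `p = (X - a)^n q`, then the derivatives of `p` of order `< n` vanish at `a`. -/
theorem eval_iterate_derivative_X_sub_C_pow_mul_of_lt (a : ℝ) (q : ℝ[X]) {j n : ℕ} (h : j < n) :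
    (derivative^[j] ((X - C a) ^ n * q)).eval a = 0 := by
  have hc : (hasseDeriv j ((X - C a) ^ n * q)).eval a = 0 := by
    rw [← taylor_coeff, taylor_mul, taylor_pow]
    simp [coeff_X_pow_mul', h]
  rw [← factorial_smul_hasseDeriv]
  simp [hc]

/-- If `p = (X - a)^n q`, then the `n`-th derivative of `p` at `a` is `n! q(a)`. -/
theorem eval_iterate_derivative_X_sub_C_pow_mul_self (a : ℝ) (q : ℝ[X]) (n : ℕ) :
    (derivative^[n] ((X - C a) ^ n * q)).eval a = n.factorial * q.eval a := by
  have hc : (hasseDeriv n ((X - C a) ^ n * q)).eval a = q.eval a := by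
    rw [← taylor_coeff, taylor_mul, taylor_pow]
    simp [coeff_X_pow_mul', taylor_coeff_zero]
  rw [← factorial_smul_hasseDeriv]
  simp [hc]

theorem X_sq_sub_one_pow_eq_one (k : ℕ) :
    ((X ^ 2 - 1 : ℝ[X]) ^ k) = (X - C 1) ^ k * (X + 1) ^ k := by
  rw [← mul_pow]; congr 1; simp only [map_one]; ring

theorem X_sq_sub_one_pow_eq_neg_one (k : ℕ) :
    ((X ^ 2 - 1 : ℝ[X]) ^ k) = (X - C (-1)) ^ k * (X - 1) ^ k := by
  rw [← mul_pow]; congr 1; simp only [map_one, map_neg]; ring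

/-- The Legendre polynomial, by Rodrigues' formula. -/
noncomputable def legendrePoly (k : ℕ) : ℝ[X] :=
  C ((2 ^ k * (k.factorial : ℝ))⁻¹) * derivative^[k] ((X ^ 2 - 1) ^ k)

theorem legendrePoly_zero : legendrePoly 0 = 1 := by simp [legendrePoly]

theorem eval_one_legendrePoly (k : ℕ) : (legendrePoly k).eval 1 = 1 := by
  rw [legendrePoly, X_sq_sub_one_pow_eq_one, eval_mul, eval_C,
    eval_iterate_derivative_X_sub_C_pow_mul_self]
  have : (k.factorial : ℝ) ≠ 0 := by positivity
  simp only [eval_pow, eval_add, eval_X, eval_one]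
  norm_num
  field_simp

theorem eval_neg_one_legendrePoly (k : ℕ) : (legendrePoly k).eval (-1) = (-1) ^ k := by
  rw [legendrePoly, X_sq_sub_one_pow_eq_neg_one, eval_mul, eval_C,
    eval_iterate_derivative_X_sub_C_pow_mul_self]
  have : (k.factorial : ℝ) ≠ 0 := by positivity
  simp only [eval_pow, eval_sub, eval_X, eval_one]
  rw [show (-1 - 1 : ℝ) = -1 * 2 by norm_num, mul_pow]
  field_simp

theorem natDegree_legendrePoly_le (k : ℕ) : (legendrePoly k).natDegree ≤ k := by
  have h1 : ((X ^ 2 - 1 : ℝ[X]) ^ k).natDegree ≤ k * 2 := by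
    refine natDegree_pow_le_of_le k ?_
    compute_degree
  have h2 := natDegree_iterate_derivative ((X ^ 2 - 1 : ℝ[X]) ^ k) k
  have h3 := natDegree_C_mul_le ((2 ^ k * (k.factorial : ℝ))⁻¹) (derivative^[k] ((X ^ 2 - 1) ^ k))
  unfold legendrePoly
  omega

theorem derivative_legendrePoly_one : derivative (legendrePoly 1) = legendrePoly 0 := by
  have h : (1 + 1 : ℝ[X]) = C 2 := by rw [one_add_one_eq_two]; rfl
  simp [legendrePoly, h, ← C_mul]

theorem derivative_legendrePoly_add_two (k : ℕ) :
    derivative (legendrePoly (k + 2)) =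
      C (2 * (k : ℝ) + 3) * legendrePoly (k + 1) + derivative (legendrePoly k) := by
  have key : derivative^[2] ((X ^ 2 - 1 : ℝ[X]) ^ (k + 2)) =
      C (2 * ((k : ℝ) + 2) * (2 * k + 3)) * (X ^ 2 - 1) ^ (k + 1) +
        C (4 * ((k : ℝ) + 2) * (k + 1)) * (X ^ 2 - 1) ^ k := by
    simp only [Function.iterate_succ, Function.iterate_zero, Function.comp_apply, id,
      derivative_pow, derivative_mul, derivative_sub, derivative_X, derivative_one,
      Nat.add_sub_cancel, Nat.cast_add, Nat.cast_ofNat, Nat.cast_one, map_add, map_mul, map_one,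
      map_ofNat, map_natCast, show k + 2 - 1 = k + 1 from rfl]
    norm_num
    ring
  have h1 : derivative (legendrePoly (k + 2)) = C ((2 ^ (k + 2) * ((k + 2).factorial : ℝ))⁻¹) *
      derivative^[k + 1] (derivative^[2] ((X ^ 2 - 1 : ℝ[X]) ^ (k + 2))) := by
    rw [legendrePoly, derivative_C_mul, ← Function.iterate_succ_apply' derivative,
      ← Function.iterate_add_apply]
  rw [h1, key, iterate_map_add, iterate_derivative_C_mul, iterate_derivative_C_mul, mul_add,
    legendrePoly, legendrePoly, derivative_C_mul, ← Function.iterate_succ_apply' derivative]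
  simp only [← mul_assoc, ← C_mul]
  have hk : (k.factorial : ℝ) ≠ 0 := by positivity
  congr 3
  · rw [Nat.factorial_succ (k + 1)]
    push_cast
    have : ((k + 1).factorial : ℝ) ≠ 0 := by positivity
    field_simp
    ring
  · rw [Nat.factorial_succ (k + 1), Nat.factorial_succ k]
    push_cast
    field_simp
    ring

theorem intervalIntegrable_eval (p : ℝ[X]) :
    IntervalIntegrable (fun x => p.eval x) MeasureTheory.volume (-1) 1 :=
  p.continuous.intervalIntegrable _ _

/-- Integration over `[-1, 1]` as a linear functional on polynomials. -/
noncomputable def symmInt : ℝ[X] →ₗ[ℝ] ℝ where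
  toFun p := ∫ x in (-1 : ℝ)..1, p.eval x
  map_add' p q := by
    simp only [eval_add]
    exact intervalIntegral.integral_add (intervalIntegrable_eval p) (intervalIntegrable_eval q)
  map_smul' a p := by simp

theorem symmInt_apply (p : ℝ[X]) : symmInt p = ∫ x in (-1 : ℝ)..1, p.eval x := rfl

theorem symmInt_C_mul (a : ℝ) (p : ℝ[X]) : symmInt (C a * p) = a * symmInt p := by
  rw [← smul_eq_C_mul, map_smul, smul_eq_mul]

theorem symmInt_derivative (p : ℝ[X]) : symmInt (derivative p) = p.eval 1 - p.eval (-1) :=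
  intervalIntegral.integral_eq_sub_of_hasDerivAt (fun x _ => p.hasDerivAt x)
    (intervalIntegrable_eval _)

theorem symmInt_derivative_mul (p q : ℝ[X]) :
    symmInt (derivative p * q) =
      p.eval 1 * q.eval 1 - p.eval (-1) * q.eval (-1) - symmInt (p * derivative q) := by
  have h := symmInt_derivative (p * q)
  rw [derivative_mul, map_add, eval_mul, eval_mul] at h
  linarith

theorem symmInt_sq_nonneg (p : ℝ[X]) : 0 ≤ symmInt (p ^ 2) := by
  rw [symmInt_apply]
  refine intervalIntegral.integral_nonneg (by norm_num) fun x _ => ?_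
  rw [eval_pow]; positivity

theorem symmInt_iterate_derivative_mul_eq_zero (k m : ℕ) (hm : m ≤ k) (q : ℝ[X])
    (hq : q.natDegree < m) : symmInt (derivative^[m] ((X ^ 2 - 1) ^ k) * q) = 0 := by
  induction m generalizing q with
  | zero => omega
  | succ m ih =>
    have h1 : (derivative^[m] ((X ^ 2 - 1 : ℝ[X]) ^ k)).eval 1 = 0 := by
      rw [X_sq_sub_one_pow_eq_one]
      exact eval_iterate_derivative_X_sub_C_pow_mul_of_lt _ _ hm
    have h2 : (derivative^[m] ((X ^ 2 - 1 : ℝ[X]) ^ k)).eval (-1) = 0 := by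
      rw [X_sq_sub_one_pow_eq_neg_one]
      exact eval_iterate_derivative_X_sub_C_pow_mul_of_lt _ _ hm
    rw [Function.iterate_succ_apply', symmInt_derivative_mul, h1, h2]
    by_cases h0 : q.natDegree = 0
    · rw [derivative_of_natDegree_zero h0]; simp
    · rw [ih (by omega) _ (by have := natDegree_derivative_lt h0; omega)]; simp

theorem symmInt_legendrePoly_mul_eq_zero (k : ℕ) (q : ℝ[X]) (hq : q.natDegree < k) :
    symmInt (legendrePoly k * q) = 0 := by
  rw [legendrePoly, mul_assoc, symmInt_C_mul,
    symmInt_iterate_derivative_mul_eq_zero k k le_rfl q hq, mul_zero]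

/-- The integral over `[-1, 1]` of the `r`-th derivative of `P_k` against `P_l`. -/
noncomputable def legendreDerivInner (r k l : ℕ) : ℝ :=
  symmInt (derivative^[r] (legendrePoly k) * legendrePoly l)

theorem legendreDerivInner_zero_of_ne {k l : ℕ} (h : k ≠ l) : legendreDerivInner 0 k l = 0 := by
  unfold legendreDerivInner
  rcases lt_or_gt_of_ne h with h | h
  · rw [mul_comm]
    exact symmInt_legendrePoly_mul_eq_zero l _ ((natDegree_legendrePoly_le k).trans_lt h)
  · exact symmInt_legendrePoly_mul_eq_zero k _ ((natDegree_legendrePoly_le l).trans_lt h)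

theorem legendreDerivInner_eq_zero_of_lt {r k l : ℕ} (h : k < l + r) :
    legendreDerivInner r k l = 0 := by
  unfold legendreDerivInner
  rcases lt_or_ge k r with hk | hk
  · rw [iterate_derivative_eq_zero ((natDegree_legendrePoly_le k).trans_lt hk)]; simp
  · rw [mul_comm]
    refine symmInt_legendrePoly_mul_eq_zero l _ ?_
    have := natDegree_iterate_derivative (legendrePoly k) r
    have := natDegree_legendrePoly_le k
    omega

theorem legendreDerivInner_add_two (r k l : ℕ) :
    legendreDerivInner (r + 1) (k + 2) l =
      (2 * (k : ℝ) + 3) * legendreDerivInner r (k + 1) l + legendreDerivInner (r + 1) k l := by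
  unfold legendreDerivInner
  rw [Function.iterate_succ_apply, derivative_legendrePoly_add_two, iterate_map_add,
    iterate_derivative_C_mul, add_mul, mul_assoc, map_add, symmInt_C_mul,
    Function.iterate_succ_apply]

theorem legendreDerivInner_one_succ_self (l : ℕ) : legendreDerivInner 1 (l + 1) l = 2 := by
  unfold legendreDerivInner
  rw [Function.iterate_one, symmInt_derivative_mul,
    symmInt_legendrePoly_mul_eq_zero _ _ (by
      have := natDegree_derivative_le (legendrePoly l)
      have := natDegree_legendrePoly_le l
      omega)]
  simp only [eval_one_legendrePoly, eval_neg_one_legendrePoly]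
  rw [← pow_add, show l + 1 + l = 2 * l + 1 by ring, pow_succ, pow_mul]
  norm_num

theorem legendreDerivInner_zero_self (l : ℕ) :
    legendreDerivInner 0 l l = 2 / (2 * (l : ℝ) + 1) := by
  rcases l with _ | k
  · unfold legendreDerivInner
    simp [legendrePoly_zero, symmInt_apply]
    norm_num
  · have h := legendreDerivInner_add_two 0 k (k + 1)
    rw [legendreDerivInner_one_succ_self, legendreDerivInner_eq_zero_of_lt (r := 0 + 1) (k := k) (by omega)] at h
    push_cast
    rw [eq_div_iff (by positivity)]
    linarith

theorem legendreDerivInner_nonneg (r k l : ℕ) : 0 ≤ legendreDerivInner r k l := by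
  induction r generalizing k with
  | zero =>
    rcases eq_or_ne k l with rfl | h
    · rw [legendreDerivInner_zero_self]; positivity
    · rw [legendreDerivInner_zero_of_ne h]
  | succ r ih =>
    induction k using Nat.twoStepInduction with
    | zero => rw [legendreDerivInner_eq_zero_of_lt (by omega)]
    | one =>
      have := ih 0
      unfold legendreDerivInner at this ⊢
      rwa [Function.iterate_succ_apply, derivative_legendrePoly_one]
    | more k h0 _ =>
      rw [legendreDerivInner_add_two]
      have := ih (k + 1)
      positivity

theorem pow_sub_pow_le_mul {a b : ℝ} (hb : 0 ≤ b) (hab : b ≤ a) (n : ℕ) :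
    a ^ n - b ^ n ≤ (a - b) * n * a ^ (n - 1) := by
  have h := abs_pow_sub_pow_le a b n
  rw [abs_of_nonneg (sub_nonneg.2 hab), abs_of_nonneg hb, abs_of_nonneg (hb.trans hab),
    max_eq_left hab] at h
  exact (le_abs_self _).trans h

/-- Lower bound for `∫ P_k^{(s+1)} P_l` when `k - l - s` is odd. -/
theorem le_legendreDerivInner (s i l : ℕ) :
    2 * (((l : ℝ) + 1 + 2 * i) * (l + 2 + 2 * i) - l * (l + 1)) ^ s /
      (2 ^ s * (s.factorial : ℝ)) ≤ legendreDerivInner (s + 1) (l + s + 1 + 2 * i) l := by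
  induction s generalizing i with
  | zero =>
    simp only [pow_zero, Nat.factorial_zero, Nat.cast_one, mul_one, div_one, add_zero, zero_add]
    induction i with
    | zero => exact (legendreDerivInner_one_succ_self l).ge
    | succ i ih =>
      rw [show l + 1 + 2 * (i + 1) = (l + 1 + 2 * i) + 2 by ring, legendreDerivInner_add_two]
      have := legendreDerivInner_nonneg 0 (l + 1 + 2 * i + 1) l
      have : 0 ≤ (2 * ((l + 1 + 2 * i : ℕ) : ℝ) + 3) *
        legendreDerivInner 0 (l + 1 + 2 * i + 1) l := by positivity
      linarith
  | succ s ih =>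
    set D : ℝ := 2 ^ s * (s.factorial : ℝ) with hD
    have hDpos : 0 < D := by positivity
    have hD' : (2 : ℝ) ^ (s + 1) * ((s + 1).factorial : ℝ) = 2 * (s + 1) * D := by
      rw [Nat.factorial_succ, hD]; push_cast; ring
    rw [hD']
    have step : ∀ a b c x y I : ℝ, 0 ≤ b → b ≤ a → a - b ≤ 2 * c → 2 * a ^ s / D ≤ I →
        2 * b ^ (s + 1) / (2 * (s + 1) * D) ≤ y → x = c * I + y →
        2 * a ^ (s + 1) / (2 * (s + 1) * D) ≤ x := by
      intro a b c x y I hb hab hc hI hy hx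
      have hp := pow_sub_pow_le_mul hb hab (s + 1)
      rw [Nat.add_sub_cancel] at hp
      have ha : 0 ≤ a ^ s := pow_nonneg (hb.trans hab) s
      have h1 : (a - b) * ((s + 1 : ℕ) : ℝ) * a ^ s ≤ 2 * c * ((s + 1 : ℕ) : ℝ) * a ^ s := by
        gcongr
      have hc0 : 0 ≤ c := by linarith
      have h2 : c * (2 * a ^ s / D) ≤ c * I := by gcongr
      have h3 : 2 * a ^ (s + 1) / (2 * (s + 1) * D) - 2 * b ^ (s + 1) / (2 * (s + 1) * D) ≤
          c * (2 * a ^ s / D) := by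
        rw [← sub_div, mul_div_assoc', div_le_div_iff₀ (by positivity) hDpos]
        push_cast at h1 hp
        nlinarith
      linarith
    induction i with
    | zero =>
      have hr := legendreDerivInner_add_two (s + 1) (l + s) l
      refine step _ 0 _ _ _ _ le_rfl ?_ ?_ (ih 0) ?_ hr
      · push_cast; nlinarith [(Nat.cast_nonneg l : (0 : ℝ) ≤ l)]
      · push_cast; nlinarith [(Nat.cast_nonneg l : (0 : ℝ) ≤ l),
          (Nat.cast_nonneg s : (0 : ℝ) ≤ s)]
      · simp [legendreDerivInner_nonneg]
    | succ i ihi =>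
      have hr := legendreDerivInner_add_two (s + 1) (l + (s + 1) + 1 + 2 * i) l
      have hI := ih (i + 1)
      rw [show l + s + 1 + 2 * (i + 1) = l + (s + 1) + 1 + 2 * i + 1 by ring] at hI
      have hl : (0 : ℝ) ≤ l := Nat.cast_nonneg l
      have hs : (0 : ℝ) ≤ s := Nat.cast_nonneg s
      have hi : (0 : ℝ) ≤ i := Nat.cast_nonneg i
      refine step _ _ _ _ _ _ ?_ ?_ ?_ hI ihi hr
      · nlinarith [mul_nonneg hl hi, mul_nonneg hi hi]
      · push_cast; nlinarith
      · push_cast; nlinarith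

/-- Bessel's inequality for the Legendre polynomials. -/
theorem bessel_legendrePoly (p : ℝ[X]) (n : ℕ) :
    ∑ l ∈ range n, (2 * (l : ℝ) + 1) / 2 * symmInt (p * legendrePoly l) ^ 2 ≤
      symmInt (p ^ 2) := by
  induction n generalizing p with
  | zero => simpa using symmInt_sq_nonneg p
  | succ n ih =>
    set c := symmInt (p * legendrePoly n) with hc
    set a := (2 * (n : ℝ) + 1) / 2 * c with ha
    have hnorm : symmInt (legendrePoly n * legendrePoly n) = 2 / (2 * (n : ℝ) + 1) :=
      legendreDerivInner_zero_self n
    have h := ih (p - C a * legendrePoly n)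
    have hsq : symmInt ((p - C a * legendrePoly n) ^ 2) =
        symmInt (p ^ 2) - (2 * (n : ℝ) + 1) / 2 * c ^ 2 := by
      have e : (p - C a * legendrePoly n) ^ 2 = p ^ 2 - C (2 * a) * (p * legendrePoly n) +
          C (a ^ 2) * (legendrePoly n * legendrePoly n) := by
        simp only [C_mul, C_pow, map_ofNat]; ring
      rw [e, map_add, map_sub, symmInt_C_mul, symmInt_C_mul, hnorm, ← hc, ha]
      field_simp
      ring
    have hco : ∀ l ∈ range n, symmInt ((p - C a * legendrePoly n) * legendrePoly l) =
        symmInt (p * legendrePoly l) := by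
      intro l hl
      have hz : symmInt (legendrePoly n * legendrePoly l) = 0 :=
        legendreDerivInner_zero_of_ne (mem_range.1 hl).ne'
      rw [sub_mul, map_sub, mul_assoc, symmInt_C_mul, hz, mul_zero, sub_zero]
    rw [sum_congr rfl fun l hl => by rw [hco l hl], hsq] at h
    rw [sum_range_succ]
    linarith

/-- A weighted sum of a sequence whose consecutive terms have constant sum. -/
theorem sum_two_mul_add_one_mul {v : ℕ → ℝ} {T : ℝ} (hv : ∀ l, v l + v (l + 1) = T) (n : ℕ) :
    ∑ l ∈ range (n + 1), (2 * (l : ℝ) + 1) * v l =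
      n * (n + 1) / 2 * T + (n + 1) * v n := by
  induction n with
  | zero => simp
  | succ n ih =>
    rw [sum_range_succ, ih, ← hv n]
    push_cast
    ring

/-- The `r`-th derivative of `Σ_{k ∈ S} φ_k`, as a polynomial. -/
noncomputable def legendreSumDeriv (S : Finset ℕ) (r : ℕ) : ℝ[X] :=
  ∑ k ∈ S, C (√((k : ℝ) + 1 / 2)) * derivative^[r] (legendrePoly k)

theorem symmInt_legendreSumDeriv_mul (S : Finset ℕ) (r l : ℕ) :
    symmInt (legendreSumDeriv S r * legendrePoly l) =
      ∑ k ∈ S, √((k : ℝ) + 1 / 2) * legendreDerivInner r k l := by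
  rw [legendreSumDeriv, sum_mul, map_sum]
  refine sum_congr rfl fun k _ => ?_
  rw [mul_assoc, symmInt_C_mul, legendreDerivInner]

theorem card_mul_le_symmInt_legendreSumDeriv_mul {S : Finset ℕ} {N m L l : ℕ} {q : ℝ}
    (hS : S ⊆ Icc (N + (m + 1)) (3 * N + (m + 1))) (hL : L ≤ N) (hl : l ≤ L) (hq : 0 ≤ q)
    (hqL : q + L * (L + 1) ≤ ((N : ℝ) + 1) * (N + 2)) :
    (#{k ∈ S | k % 2 = (l + (m + 1)) % 2} : ℝ) *
        (√N * (2 * q ^ m / (2 ^ m * (m.factorial : ℝ)))) ≤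
      symmInt (legendreSumDeriv S (m + 1) * legendrePoly l) := by
  rw [symmInt_legendreSumDeriv_mul, ← nsmul_eq_mul, ← sum_const]
  refine (sum_le_sum (g := fun k : ℕ => √((k : ℝ) + 1 / 2) * legendreDerivInner (m + 1) k l)
    fun k hk => ?_).trans (sum_le_sum_of_subset_of_nonneg (filter_subset _ _) fun k _ _ =>
      mul_nonneg (Real.sqrt_nonneg _) (legendreDerivInner_nonneg _ _ _))
  obtain ⟨hkS, hpar⟩ := mem_filter.1 hk
  have hkN := (mem_Icc.1 (hS hkS)).1
  obtain ⟨i, rfl⟩ : ∃ i, k = l + m + 1 + 2 * i := ⟨(k - (l + m + 1)) / 2, by omega⟩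
  have hi : (N : ℝ) + 1 ≤ (l : ℝ) + 1 + 2 * i := by
    have : N + 1 ≤ l + 1 + 2 * i := by omega
    exact_mod_cast this
  have hNk : (N : ℝ) ≤ ((l + m + 1 + 2 * i : ℕ) : ℝ) := by
    have : N ≤ l + m + 1 + 2 * i := by omega
    exact_mod_cast this
  have hlL : (l : ℝ) ≤ L := by exact_mod_cast hl
  have hl0 : (0 : ℝ) ≤ l := Nat.cast_nonneg l
  have hN0 : (0 : ℝ) ≤ N := Nat.cast_nonneg N
  have hmono : q ≤ ((l : ℝ) + 1 + 2 * i) * (l + 2 + 2 * i) - l * (l + 1) := by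
    nlinarith
  refine mul_le_mul (Real.sqrt_le_sqrt (by linarith))
    (le_trans ?_ (le_legendreDerivInner m i l)) (by positivity) (Real.sqrt_nonneg _)
  gcongr

theorem card_filter_mod_two_add (S : Finset ℕ) (j : ℕ) :
    #{k ∈ S | k % 2 = j % 2} + #{k ∈ S | k % 2 = (j + 1) % 2} = #S := by
  rw [← card_filter_add_card_filter_not (s := S) (fun k => k % 2 = j % 2)]
  congr 2
  refine filter_congr fun k _ => ?_
  omega

theorem le_symmInt_legendreSumDeriv_sq_of_le {S : Finset ℕ} {N m L : ℕ} {q : ℝ}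
    (hcard : #S = N) (hS : S ⊆ Icc (N + (m + 1)) (3 * N + (m + 1))) (hL : L ≤ N) (hq : 0 ≤ q)
    (hqL : q + L * (L + 1) ≤ ((N : ℝ) + 1) * (N + 2)) :
    (N : ℝ) ^ 3 * (L * (L + 1)) * (q ^ m) ^ 2 / (2 * (2 ^ m * (m.factorial : ℝ)) ^ 2) ≤
      symmInt (legendreSumDeriv S (m + 1) ^ 2) := by
  refine le_trans ?_ (bessel_legendrePoly _ (L + 1))
  set D : ℝ := 2 ^ m * (m.factorial : ℝ) with hD
  have hDpos : 0 < D := by positivity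
  set A : ℝ := √N * (2 * q ^ m / D) with hA
  have hA0 : 0 ≤ A := by positivity
  have hA2 : A ^ 2 = N * (4 * (q ^ m) ^ 2 / D ^ 2) := by
    rw [hA, mul_pow, Real.sq_sqrt (Nat.cast_nonneg N)]; ring
  set n : ℕ → ℝ := fun j => (#{k ∈ S | k % 2 = j % 2} : ℝ) with hn
  have hnadd : ∀ j, n j + n (j + 1) = N := fun j => by
    rw [← hcard, ← card_filter_mod_two_add S j, Nat.cast_add]
  have hv' : ∀ j, n j ^ 2 + n (j + 1) ^ 2 = n 0 ^ 2 + n 1 ^ 2 := by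
    intro j
    induction j with
    | zero => rfl
    | succ j ih =>
      have h2 : n (j + 1 + 1) = n j := by linarith [hnadd j, hnadd (j + 1)]
      rw [h2, ← ih, add_comm]
  have hv : ∀ l, n (l + (m + 1)) ^ 2 + n (l + 1 + (m + 1)) ^ 2 = n 0 ^ 2 + n 1 ^ 2 := by
    intro l
    rw [add_right_comm l 1]
    exact hv' _
  have hsum := sum_two_mul_add_one_mul hv L
  have hT : (N : ℝ) ^ 2 / 2 ≤ n 0 ^ 2 + n 1 ^ 2 := by
    rw [← hnadd 0]; nlinarith [sq_nonneg (n 0 - n 1)]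
  calc (N : ℝ) ^ 3 * (L * (L + 1)) * (q ^ m) ^ 2 / (2 * D ^ 2)
      = A ^ 2 / 2 * (L * (L + 1) / 2 * ((N : ℝ) ^ 2 / 2)) := by
        rw [hA2]; field_simp; norm_num
    _ ≤ A ^ 2 / 2 * (L * (L + 1) / 2 * (n 0 ^ 2 + n 1 ^ 2) +
          (L + 1) * n (L + (m + 1)) ^ 2) := by
        gcongr
        have : 0 ≤ ((L : ℝ) + 1) * n (L + (m + 1)) ^ 2 := by positivity
        have : (L : ℝ) * (L + 1) / 2 * ((N : ℝ) ^ 2 / 2) ≤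
          L * (L + 1) / 2 * (n 0 ^ 2 + n 1 ^ 2) := by gcongr
        linarith
    _ = ∑ l ∈ range (L + 1), (2 * (l : ℝ) + 1) / 2 * (n (l + (m + 1)) * A) ^ 2 := by
        rw [← hsum, mul_sum]
        exact sum_congr rfl fun l _ => by ring
    _ ≤ _ := by
        refine sum_le_sum fun l hl => ?_
        have := card_mul_le_symmInt_legendreSumDeriv_mul hS hL
          (Nat.lt_succ_iff.1 (mem_range.1 hl)) hq hqL
        gcongr

/-- The squared `L₂([-1,1])` norm of `Σ_{k ∈ S} φ_k^{(m+1)}` is at least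
`N^{4m+5} / (2^{3m+1} m!)²`. -/
theorem le_symmInt_legendreSumDeriv_sq {S : Finset ℕ} {N m : ℕ} (hN : 1 ≤ N)
    (hcard : #S = N) (hS : S ⊆ Icc (N + (m + 1)) (3 * N + (m + 1))) :
    (N : ℝ) ^ (4 * m + 5) / (2 ^ (3 * m + 1) * (m.factorial : ℝ)) ^ 2 ≤
      symmInt (legendreSumDeriv S (m + 1) ^ 2) := by
  have hN1 : (1 : ℝ) ≤ N := by exact_mod_cast hN
  rcases Nat.eq_zero_or_pos m with rfl | hm
  · refine le_trans ?_ (le_symmInt_legendreSumDeriv_sq_of_le hcard hS le_rfl le_rfl (by nlinarith))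
    norm_num
    have : 0 ≤ (N : ℝ) ^ 5 := by positivity
    have : 0 ≤ (N : ℝ) ^ 4 := by positivity
    nlinarith
  · have hL : (N + 1) / 2 ≤ N := by omega
    have hL1 : (N : ℝ) / 2 ≤ (((N + 1) / 2 : ℕ) : ℝ) := by
      have : N ≤ 2 * ((N + 1) / 2) := by omega
      have : (N : ℝ) ≤ 2 * (((N + 1) / 2 : ℕ) : ℝ) := by exact_mod_cast this
      linarith
    have hL2 : (((N + 1) / 2 : ℕ) : ℝ) ≤ ((N : ℝ) + 1) / 2 := by
      have : 2 * ((N + 1) / 2) ≤ N + 1 := by omega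
      have : 2 * (((N + 1) / 2 : ℕ) : ℝ) ≤ (N : ℝ) + 1 := by exact_mod_cast this
      linarith
    refine le_trans ?_ (le_symmInt_legendreSumDeriv_sq_of_le (q := 3 * (N : ℝ) ^ 2 / 4) hcard hS hL
      (by positivity) (by nlinarith))
    set L : ℝ := (((N + 1) / 2 : ℕ) : ℝ)
    have hLL : (N : ℝ) ^ 2 / 4 ≤ L * (L + 1) := by nlinarith
    have h9 : (2 : ℝ) ≤ 9 ^ m := by
      calc (2 : ℝ) ≤ 9 ^ 1 := by norm_num
        _ ≤ 9 ^ m := pow_le_pow_right₀ (by norm_num) hm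
    calc (N : ℝ) ^ (4 * m + 5) / (2 ^ (3 * m + 1) * (m.factorial : ℝ)) ^ 2
        = 2 * (N : ℝ) ^ (4 * m + 5) / (8 * 64 ^ m * (m.factorial : ℝ) ^ 2) := by
          rw [show (64 : ℝ) = 2 ^ 6 by norm_num, ← pow_mul]
          field_simp
          ring
      _ ≤ 9 ^ m * (N : ℝ) ^ (4 * m + 5) / (8 * 64 ^ m * (m.factorial : ℝ) ^ 2) := by gcongr
      _ = (N : ℝ) ^ 3 * ((N : ℝ) ^ 2 / 4) * ((3 * (N : ℝ) ^ 2 / 4) ^ m) ^ 2 /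
            (2 * (2 ^ m * (m.factorial : ℝ)) ^ 2) := by
          rw [show (64 : ℝ) = 2 ^ 6 by norm_num, show (9 : ℝ) = 3 ^ 2 by norm_num,
            show (4 : ℝ) = 2 ^ 2 by norm_num, ← pow_mul, ← pow_mul]
          simp only [div_pow, mul_pow, ← pow_mul]
          field_simp
          ring
      _ ≤ _ := by gcongr

theorem iteratedDeriv_eval (p : ℝ[X]) (n : ℕ) :
    iteratedDeriv n (fun x => p.eval x) = fun x => (derivative^[n] p).eval x := by
  induction n with
  | zero => simp
  | succ n ih =>
    rw [iteratedDeriv_succ, ih, Function.iterate_succ_apply']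
    funext x
    exact Polynomial.deriv _

theorem legP_eq_eval (k : ℕ) :
    legP k = fun t => (C (√((k : ℝ) + 1 / 2)) * legendrePoly k).eval t := by
  funext t
  have h : (fun x : ℝ => (x ^ 2 - 1) ^ k) = fun x => ((X ^ 2 - 1 : ℝ[X]) ^ k).eval x := by
    simp
  rw [legP, h, iteratedDeriv_eval]
  simp [legendrePoly, mul_assoc]

theorem gDiff_eq (ctil : ℝ) (N : ℕ) (μ₁ s : ℝ) (S : Finset ℕ) (r : ℕ) (t τ : ℝ) :
    gDiff ctil N μ₁ s S r t τ =
      ctil * (N : ℝ) ^ (-μ₁ - 1 / s) * legP 1 τ * (legendreSumDeriv S r).eval t := by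
  rw [gDiff, legendreSumDeriv, eval_finsetSum]
  congr 1
  refine sum_congr rfl fun k _ => ?_
  rw [legP_eq_eval, iteratedDeriv_eval, iterate_derivative_C_mul]

theorem integral_legP_one_sq : ∫ τ in (-1 : ℝ)..1, legP 1 τ ^ 2 = 1 := by
  have h : ∀ τ, legP 1 τ ^ 2 =
      (C (3 / 2) * (legendrePoly 1 * legendrePoly 1) : ℝ[X]).eval τ := fun τ => by
    rw [legP_eq_eval]
    simp only [eval_mul, eval_C, mul_pow]
    rw [Real.sq_sqrt (by positivity)]
    norm_num
    ring
  simp_rw [h]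
  rw [← symmInt_apply, symmInt_C_mul]
  have := legendreDerivInner_zero_self 1
  simp only [legendreDerivInner, Function.iterate_zero, id] at this
  rw [this]; norm_num

theorem integral_gDiff_sq (ctil : ℝ) (N : ℕ) (μ₁ s : ℝ) (S : Finset ℕ) (r : ℕ) :
    ∫ t in (-1 : ℝ)..1, ∫ τ in (-1 : ℝ)..1, gDiff ctil N μ₁ s S r t τ ^ 2 =
      (ctil * (N : ℝ) ^ (-μ₁ - 1 / s)) ^ 2 * symmInt (legendreSumDeriv S r ^ 2) := by
  have h : ∀ t τ, gDiff ctil N μ₁ s S r t τ ^ 2 =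
      ((ctil * (N : ℝ) ^ (-μ₁ - 1 / s)) ^ 2 * (legendreSumDeriv S r ^ 2).eval t) *
        legP 1 τ ^ 2 := fun t τ => by
    rw [gDiff_eq, eval_pow]; ring
  simp_rw [h, intervalIntegral.integral_const_mul, integral_legP_one_sq, mul_one]
  rw [intervalIntegral.integral_const_mul, symmInt_apply]

end LegendrePolynomials

/-- `‖f₁^{(r,0)} - f₂^{(r,0)}‖_{L₂([-1,1]²)} ≥ (c̃ / (2^{3r-2} (r-1)!)) N^{-μ₁+2r-1/s+1/2}`. -/
theorem f1_deriv_L2_lower_bound (s μ₁ : ℝ) (hs : 1 ≤ s) (hμ₁ : 0 < μ₁)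
    (r N : ℕ) (hr : 1 ≤ r) (hN : 1 ≤ N) (ctil : ℝ) (hc : 0 < ctil)
    (S : Finset ℕ) (hcard : S.card = N) (hSsub : S ⊆ Finset.Icc (N + r) (3 * N + r)) :
    ctil / (2 ^ (3 * r - 2) * (Nat.factorial (r - 1) : ℝ)) *
        (N : ℝ) ^ (-μ₁ + 2 * (r : ℝ) - 1 / s + 1 / 2) ≤
      Real.sqrt (∫ t in (-1 : ℝ)..1, ∫ τ in (-1 : ℝ)..1,
        (gDiff ctil N μ₁ s S r t τ) ^ 2) := by
  obtain ⟨m, rfl⟩ : ∃ m, r = m + 1 := ⟨r - 1, by omega⟩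
  have hNpos : (0 : ℝ) < N := by exact_mod_cast hN
  rw [integral_gDiff_sq, show 3 * (m + 1) - 2 = 3 * m + 1 by omega, Nat.add_sub_cancel]
  refine Real.le_sqrt_of_sq_le ?_
  have hsplit : (N : ℝ) ^ (-μ₁ + 2 * ((m + 1 : ℕ) : ℝ) - 1 / s + 1 / 2) =
      (N : ℝ) ^ (-μ₁ - 1 / s) * (N : ℝ) ^ (2 * (m : ℝ) + 5 / 2) := by
    rw [← Real.rpow_add hNpos]
    congr 1
    push_cast
    ring
  have hsq : ((N : ℝ) ^ (2 * (m : ℝ) + 5 / 2)) ^ 2 = (N : ℝ) ^ (4 * m + 5) := by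
    rw [← Real.rpow_natCast, ← Real.rpow_mul hNpos.le, ← Real.rpow_natCast]
    congr 1
    push_cast
    ring
  calc (ctil / (2 ^ (3 * m + 1) * (m.factorial : ℝ)) *
          (N : ℝ) ^ (-μ₁ + 2 * ((m + 1 : ℕ) : ℝ) - 1 / s + 1 / 2)) ^ 2
      = (ctil * (N : ℝ) ^ (-μ₁ - 1 / s)) ^ 2 *
          ((N : ℝ) ^ (4 * m + 5) / (2 ^ (3 * m + 1) * (m.factorial : ℝ)) ^ 2) := by
        rw [hsplit, ← hsq]; ring
    _ ≤ _ := by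
        gcongr
        exact le_symmInt_legendreSumDeriv_sq hN hcard hSsub
end

section
/- Let f ∈ L_{s,2}^{μ̄} with 1 ≤ s < ∞, μ₁ > 2r − 1/s + 3/2, μ₂ > μ₁ − 2r, and 1 ≤ γ < (μ₂ + 1/s − 3/2)/(μ₁ − 2r + 1/s − 3/2). Then ‖f^{(r,0)} − D_{n,γ}^{(r,0)} f‖_C ≤ c·‖f‖_{s,μ̄}·n^{−μ₁+2r−1/s+3/2}. -/
open Finset

/-- The `r`-th partial derivative in `t` of the function with Fourier–Legendre
coefficients `a`, defined by the termwise differentiated series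
`f^{(r,0)}(t,τ) = Σ_{k,j} ⟨f,φ_{k,j}⟩ φ_k^{(r)}(t) φ_j(τ)`
(terms with `k < r` vanish since `deg φ_k = k`). -/
noncomputable def Fderiv (r : ℕ) (a : ℕ → ℕ → ℝ) (t τ : ℝ) : ℝ :=
  ∑' q : ℕ × ℕ, a q.1 q.2 * iteratedDeriv r (legP q.1) t * legP q.2 τ

/-- The truncation method on the hyperbolic cross
`Γ_{n,γ} = {(k,j) : k·j^γ ≤ n, r ≤ k ≤ n}`:
`D_{n,γ}^{(r,0)} f(t,τ) = Σ_{k=r}^n Σ_{j=0}^{(n/k)^{1/γ}} ⟨f,φ_{k,j}⟩ φ_k^{(r)}(t) φ_j(τ)`. -/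
noncomputable def Dtrunc (r n : ℕ) (γ : ℝ) (a : ℕ → ℕ → ℝ) (t τ : ℝ) : ℝ :=
  ∑ k ∈ Finset.Icc r n, ∑ j ∈ Finset.range (n + 1),
    if (k : ℝ) * (j : ℝ) ^ γ ≤ (n : ℝ) then
      a k j * iteratedDeriv r (legP k) t * legP j τ
    else 0

/-- The weight of the class `L_{s,2}^{μ̄}`:
`w(k,j) = max(1,k)^{sμ₁} max(1,j)^{sμ₂} |⟨f,φ_{k,j}⟩|^s`. -/
noncomputable def wTerm (s μ₁ μ₂ : ℝ) (a : ℕ → ℕ → ℝ) (q : ℕ × ℕ) : ℝ :=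
  ((max 1 q.1 : ℕ) : ℝ) ^ (s * μ₁) * ((max 1 q.2 : ℕ) : ℝ) ^ (s * μ₂) * |a q.1 q.2| ^ s

/-- The norm `‖f‖_{s,μ̄}` of `L_{s,2}^{μ̄}`. -/
noncomputable def wNorm (s μ₁ μ₂ : ℝ) (a : ℕ → ℕ → ℝ) : ℝ :=
  (∑' q : ℕ × ℕ, wTerm s μ₁ μ₂ a q) ^ (1 / s)

/-- The `L₂` norm on the square `Q = [-1,1]²`. -/
noncomputable def L2norm (g : ℝ → ℝ → ℝ) : ℝ :=
  Real.sqrt (∫ t in (-1 : ℝ)..1, ∫ τ in (-1 : ℝ)..1, (g t τ) ^ 2)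

/-- `ℓ_p` norm of a doubly-indexed sequence, `1 ≤ p ≤ ∞`. -/
noncomputable def lpNorm (p : ENNReal) (x : ℕ × ℕ → ℝ) : ℝ :=
  if p = ⊤ then ⨆ q, |x q| else (∑' q : ℕ × ℕ, |x q| ^ p.toReal) ^ (1 / p.toReal)

section Legendre

open Polynomial

/-- The energy `p² + (1 - x²) p'² / lam` of a polynomial solution of a Gegenbauer equation grows
with `|x|`, so such a polynomial is bounded on `[-1,1]` by its values at the end points. -/
theorem Polynomial.abs_eval_le_of_gegenbauer (p : Polynomial ℝ) {lam b M : ℝ} (hlam : 0 < lam)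
    (hb : 1 ≤ 2 * b)
    (hode : ∀ x : ℝ, (1 - x ^ 2) * p.derivative.derivative.eval x
      - 2 * b * x * p.derivative.eval x + lam * p.eval x = 0)
    (h1 : |p.eval 1| ≤ M) (h2 : |p.eval (-1)| ≤ M) {t : ℝ} (ht : t ∈ Set.Icc (-1 : ℝ) 1) :
    |p.eval t| ≤ M := by
  have hM : 0 ≤ M := (abs_nonneg _).trans h1
  set H : Polynomial ℝ := p ^ 2 + C lam⁻¹ * (1 - X ^ 2) * p.derivative ^ 2 with hH
  have hHe : ∀ x, H.eval x = p.eval x ^ 2 + lam⁻¹ * (1 - x ^ 2) * p.derivative.eval x ^ 2 := by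
    intro x; simp [hH]
  have hd : ∀ x, deriv (fun y => H.eval y) x
      = lam⁻¹ * (4 * b - 2) * x * p.derivative.eval x ^ 2 := by
    intro x
    rw [Polynomial.deriv]
    have : H.derivative.eval x = 2 * p.eval x * p.derivative.eval x + lam⁻¹ *
        (-(2 * x) * p.derivative.eval x ^ 2 + (1 - x ^ 2) *
          (2 * p.derivative.eval x * p.derivative.derivative.eval x)) := by
      simp [hH, derivative_pow]; ring
    rw [this]
    have h := hode x
    field_simp
    linear_combination (2 * p.derivative.eval x) * h
  have hle : ∀ x ∈ Set.Icc (-1 : ℝ) 1, p.eval x ^ 2 ≤ H.eval x := by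
    intro x hx
    rw [hHe]
    have : 0 ≤ 1 - x ^ 2 := by nlinarith [hx.1, hx.2]
    have := mul_nonneg (mul_nonneg (inv_nonneg.2 hlam.le) this)
      (sq_nonneg (p.derivative.eval x))
    linarith
  have hc : 0 ≤ lam⁻¹ * (4 * b - 2) := mul_nonneg (inv_nonneg.2 hlam.le) (by linarith)
  have hbd : H.eval t ≤ M ^ 2 := by
    rcases le_total 0 t with h0 | h0
    · have hm : MonotoneOn (fun y => H.eval y) (Set.Icc 0 1) := by
        refine monotoneOn_of_deriv_nonneg (convex_Icc _ _) H.continuous.continuousOn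
          H.differentiable.differentiableOn fun x hx => ?_
        rw [interior_Icc] at hx
        rw [hd]
        exact mul_nonneg (mul_nonneg hc hx.1.le) (sq_nonneg _)
      refine (hm ⟨h0, ht.2⟩ ⟨zero_le_one, le_rfl⟩ ht.2).trans ?_
      simp only [hHe]
      norm_num
      exact sq_le_sq.2 (h1.trans (le_abs_self M))
    · have hm : AntitoneOn (fun y => H.eval y) (Set.Icc (-1) 0) := by
        refine antitoneOn_of_deriv_nonpos (convex_Icc _ _) H.continuous.continuousOn
          H.differentiable.differentiableOn fun x hx => ?_
        rw [interior_Icc] at hx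
        rw [hd]
        exact mul_nonpos_of_nonpos_of_nonneg
          (mul_nonpos_of_nonneg_of_nonpos hc hx.2.le) (sq_nonneg _)
      refine (hm ⟨le_rfl, by norm_num⟩ ⟨ht.1, h0⟩ ht.1).trans ?_
      simp only [hHe]
      norm_num
      exact sq_le_sq.2 (h2.trans (le_abs_self M))
  exact abs_le_of_sq_le_sq ((hle t ht).trans hbd) hM

theorem Polynomial.rodrigues_ode (k m : ℕ) :
    (X ^ 2 - 1) * derivative^[m + 2] (((X : Polynomial ℝ) ^ 2 - 1) ^ k)
      + 2 * ((m : Polynomial ℝ) + 1 - (k : Polynomial ℝ)) * X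
        * derivative^[m + 1] (((X : Polynomial ℝ) ^ 2 - 1) ^ k)
      + ((m : Polynomial ℝ) + 1) * ((m : Polynomial ℝ) - 2 * (k : Polynomial ℝ))
        * derivative^[m] (((X : Polynomial ℝ) ^ 2 - 1) ^ k)
      = 0 := by
  set W : Polynomial ℝ := (X ^ 2 - 1) ^ k with hW
  have h0 : (X ^ 2 - 1) * derivative W = 2 * (k : Polynomial ℝ) * X * W := by
    rcases k with _ | k
    · simp [hW]
    · rw [hW, derivative_pow]
      simp
      ring
  induction m with
  | zero =>
    have h := congrArg derivative h0
    simp only [derivative_mul, derivative_sub, derivative_X_sq, derivative_natCast,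
      derivative_one, derivative_X, derivative_ofNat, map_ofNat] at h
    simp only [Function.iterate_succ_apply', Function.iterate_zero_apply, Nat.cast_zero]
    linear_combination h
  | succ m ih =>
    simp only [Function.iterate_succ_apply'] at ih ⊢
    have h := congrArg derivative ih
    simp only [derivative_add, derivative_mul, derivative_sub, derivative_natCast, derivative_one,
      derivative_X_sq, derivative_X, derivative_ofNat, derivative_zero, map_ofNat] at h
    push_cast
    linear_combination h

theorem Polynomial.eval_one_rodrigues (k : ℕ) :
    (derivative^[k] (((X : Polynomial ℝ) ^ 2 - 1) ^ k)).eval 1 = 2 ^ k * (k.factorial : ℝ) := by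
  have h := aeval_iterate_derivative_self (((X : Polynomial ℝ) ^ 2 - 1) ^ k) k (1 : ℝ)
    (p' := (X + 1) ^ k) (by simp [← mul_pow]; ring)
  simp only [coe_aeval_eq_eval] at h
  rw [h]
  simp
  norm_num
  ring

theorem Polynomial.eval_neg_one_rodrigues (k : ℕ) :
    (derivative^[k] (((X : Polynomial ℝ) ^ 2 - 1) ^ k)).eval (-1)
      = (-2) ^ k * (k.factorial : ℝ) := by
  have h := aeval_iterate_derivative_self (((X : Polynomial ℝ) ^ 2 - 1) ^ k) k (-1 : ℝ)
    (p' := (X - 1) ^ k) (by simp [← mul_pow]; ring)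
  simp only [coe_aeval_eq_eval] at h
  rw [h]
  simp
  norm_num
  ring

theorem Polynomial.abs_eval_rodrigues_endpoint_le {e : ℝ} (he : e = 1 ∨ e = -1) {k r : ℕ}
    (hr : r ≤ k) :
    |(derivative^[k + r] (((X : Polynomial ℝ) ^ 2 - 1) ^ k)).eval e|
      ≤ 2 ^ k * (k.factorial : ℝ) * (k : ℝ) ^ (2 * r) := by
  have he2 : e ^ 2 = 1 := by rcases he with rfl | rfl <;> norm_num
  have hea : |e| = 1 := by rcases he with rfl | rfl <;> norm_num
  induction r with
  | zero =>
    rcases he with rfl | rfl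
    · rw [add_zero, eval_one_rodrigues, abs_of_nonneg (by positivity)]
      simp
    · rw [add_zero, eval_neg_one_rodrigues, abs_mul, abs_pow]
      simp
  | succ r ih =>
    have ih := ih (by omega)
    have h := congrArg (Polynomial.eval e) (rodrigues_ode k (k + r))
    simp only [eval_add, eval_mul, eval_sub, eval_pow, eval_X, eval_one, eval_natCast,
      eval_ofNat, he2, eval_zero] at h
    push_cast at h
    rw [← add_assoc]
    set a := (derivative^[k + r] (((X : Polynomial ℝ) ^ 2 - 1) ^ k)).eval e
    set b := (derivative^[k + r + 1] (((X : Polynomial ℝ) ^ 2 - 1) ^ k)).eval e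
    have hk : (r : ℝ) + 1 ≤ k := by exact_mod_cast hr
    have hr0 : (0 : ℝ) ≤ r := Nat.cast_nonneg r
    have hb : e * (2 * (r + 1) * b) = ((k : ℝ) + r + 1) * (k - r) * a := by
      linear_combination h
    have hb' : 2 * ((r : ℝ) + 1) * |b| = ((k : ℝ) + r + 1) * (k - r) * |a| := by
      have := congrArg abs hb
      have h0 : 0 ≤ ((k : ℝ) + r + 1) * (k - r) := mul_nonneg (by positivity) (by linarith)
      rwa [abs_mul, hea, one_mul, abs_mul, abs_mul _ a, abs_of_nonneg h0,
        abs_of_nonneg (show (0 : ℝ) ≤ 2 * (r + 1) by positivity)] at this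
    have h3 : ((k : ℝ) + r + 1) * (k - r) ≤ 2 * k ^ 2 := by nlinarith
    have h4 : |b| ≤ k ^ 2 * |a| := by
      have := mul_le_mul_of_nonneg_right h3 (abs_nonneg a)
      nlinarith [mul_nonneg hr0 (abs_nonneg b)]
    refine h4.trans ?_
    calc (k : ℝ) ^ 2 * |a| ≤ k ^ 2 * (2 ^ k * (k.factorial : ℝ) * (k : ℝ) ^ (2 * r)) := by gcongr
      _ = _ := by ring

theorem Polynomial.natDegree_X_sq_sub_one_pow_le (k : ℕ) :
    (((X : Polynomial ℝ) ^ 2 - 1) ^ k).natDegree ≤ 2 * k := by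
  compute_degree
  omega

theorem Polynomial.abs_eval_rodrigues_le (k r : ℕ) {t : ℝ} (ht : t ∈ Set.Icc (-1 : ℝ) 1) :
    |(derivative^[k + r] (((X : Polynomial ℝ) ^ 2 - 1) ^ k)).eval t|
      ≤ 2 ^ k * (k.factorial : ℝ) * (k : ℝ) ^ (2 * r) := by
  have hdeg := natDegree_X_sq_sub_one_pow_le k
  rcases lt_trichotomy r k with hrk | rfl | hrk
  · have hrk' : (r : ℝ) + 1 ≤ k := by exact_mod_cast hrk
    have hr0 : (0 : ℝ) ≤ r := Nat.cast_nonneg r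
    refine abs_eval_le_of_gegenbauer _ (lam := ((k : ℝ) + r + 1) * (k - r)) (b := r + 1)
      (mul_pos (by positivity) (by linarith)) (by linarith) (fun x => ?_)
      (abs_eval_rodrigues_endpoint_le (.inl rfl) hrk.le)
      (abs_eval_rodrigues_endpoint_le (.inr rfl) hrk.le) ht
    have h := congrArg (Polynomial.eval x) (rodrigues_ode k (k + r))
    simp only [eval_add, eval_mul, eval_sub, eval_pow, eval_X, eval_one, eval_natCast,
      eval_ofNat, eval_zero, Function.iterate_succ_apply'] at h
    push_cast at h
    linear_combination -h
  · have hc : (derivative^[r + r] (((X : Polynomial ℝ) ^ 2 - 1) ^ r)).natDegree = 0 := by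
      have := natDegree_iterate_derivative (((X : Polynomial ℝ) ^ 2 - 1) ^ r) (r + r)
      omega
    have h1 := abs_eval_rodrigues_endpoint_le (.inl rfl) (le_refl r)
    rw [eq_C_of_natDegree_eq_zero hc] at h1 ⊢
    simpa using h1
  · rw [iterate_derivative_eq_zero (by omega)]
    simp only [eval_zero, abs_zero]
    positivity

theorem iteratedDeriv_polynomial_eval (p : Polynomial ℝ) (n : ℕ) :
    iteratedDeriv n (fun x => p.eval x) = fun x => (derivative^[n] p).eval x := by
  induction n with
  | zero => simp
  | succ n ih =>
    rw [iteratedDeriv_succ, ih]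
    ext x
    rw [Polynomial.deriv, Function.iterate_succ_apply']

theorem iteratedDeriv_legP (r k : ℕ) (t : ℝ) :
    iteratedDeriv r (legP k) t = Real.sqrt ((k : ℝ) + 1 / 2) *
      ((2 ^ k * (Nat.factorial k : ℝ))⁻¹) *
        (derivative^[k + r] (((X : Polynomial ℝ) ^ 2 - 1) ^ k)).eval t := by
  have h : (fun x : ℝ => (x ^ 2 - 1) ^ k)
      = fun x => (((X : Polynomial ℝ) ^ 2 - 1) ^ k).eval x := by
    ext x; simp
  unfold legP
  rw [iteratedDeriv_const_mul_field, h, iteratedDeriv_polynomial_eval,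
    iteratedDeriv_polynomial_eval, ← Function.iterate_add_apply, add_comm r k]

theorem iteratedDeriv_legP_of_lt {r k : ℕ} (h : k < r) (t : ℝ) :
    iteratedDeriv r (legP k) t = 0 := by
  have hdeg := natDegree_X_sq_sub_one_pow_le k
  rw [iteratedDeriv_legP, iterate_derivative_eq_zero (by omega), eval_zero, mul_zero]

theorem abs_iteratedDeriv_legP_le (r k : ℕ) {t : ℝ} (ht : t ∈ Set.Icc (-1 : ℝ) 1) :
    |iteratedDeriv r (legP k) t| ≤ Real.sqrt ((k : ℝ) + 1 / 2) * (k : ℝ) ^ (2 * r) := by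
  have hf : (0 : ℝ) < 2 ^ k * (Nat.factorial k : ℝ) := by positivity
  rw [iteratedDeriv_legP, abs_mul, abs_of_nonneg (by positivity), mul_assoc]
  gcongr
  rw [inv_mul_le_iff₀ hf]
  exact Polynomial.abs_eval_rodrigues_le k r ht

end Legendre

theorem rpow_neg_le_sub_rpow {q y : ℝ} (hq : 1 < q) (hy : 1 ≤ y) :
    y ^ (-q) ≤ 2 ^ q / (q - 1) * (y ^ (1 - q) - (y + 1) ^ (1 - q)) := by
  have hy0 : 0 < y := by linarith
  have hy1 : 0 < y + 1 := by linarith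
  have hu : 0 < y / (y + 1) := by positivity
  have h1 : 1 + (q - 1) * (y + 1)⁻¹ ≤ (y / (y + 1)) ^ (1 - q) := by
    have hl := Real.log_le_sub_one_of_pos hu
    have he : y / (y + 1) - 1 = -(y + 1)⁻¹ := by field_simp; ring
    rw [he] at hl
    rw [Real.rpow_def_of_pos hu]
    have := Real.add_one_le_exp (Real.log (y / (y + 1)) * (1 - q))
    nlinarith
  have h2 : y ^ (1 - q) = (y + 1) ^ (1 - q) * (y / (y + 1)) ^ (1 - q) := by
    rw [← Real.mul_rpow hy1.le hu.le, mul_div_cancel₀ _ hy1.ne']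
  have h3 : (q - 1) * (y + 1) ^ (-q) ≤ y ^ (1 - q) - (y + 1) ^ (1 - q) := by
    have h4 : (y + 1) ^ (-q) = (y + 1) ^ (1 - q) * (y + 1)⁻¹ := by
      rw [← Real.rpow_neg_one, ← Real.rpow_add hy1]; congr 1; ring
    rw [h2, h4]
    have := mul_le_mul_of_nonneg_left h1 (Real.rpow_nonneg hy1.le (1 - q))
    linarith
  have h5 : y ^ (-q) ≤ 2 ^ q * (y + 1) ^ (-q) := by
    have h6 : (2 * y) ^ (-q) ≤ (y + 1) ^ (-q) :=
      Real.rpow_le_rpow_of_nonpos hy1 (by linarith) (by linarith)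
    rw [Real.mul_rpow two_pos.le hy0.le] at h6
    calc y ^ (-q) = 2 ^ q * (2 ^ (-q) * y ^ (-q)) := by
          rw [← mul_assoc, ← Real.rpow_add two_pos]; simp
      _ ≤ _ := by gcongr
  have hq1 : 0 < q - 1 := by linarith
  calc y ^ (-q) ≤ 2 ^ q * (y + 1) ^ (-q) := h5
    _ = 2 ^ q / (q - 1) * ((q - 1) * (y + 1) ^ (-q)) := by field_simp
    _ ≤ _ := by gcongr

theorem summable_and_tsum_rpow_tail_le {q x : ℝ} (hq : 1 < q) (hx : 0 < x) :
    Summable (fun k : ℕ => if x < k then (k : ℝ) ^ (-q) else 0) ∧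
      ∑' k : ℕ, (if x < k then (k : ℝ) ^ (-q) else 0) ≤ 2 ^ q / (q - 1) * x ^ (1 - q) := by
  have hq1 : 0 < q - 1 := by linarith
  set G : ℕ → ℝ := fun k => 2 ^ q / (q - 1) * (max x k) ^ (1 - q) with hG
  have h0 : ∀ k : ℕ, 0 ≤ if x < k then (k : ℝ) ^ (-q) else 0 := fun k => by positivity
  have hstep : ∀ k : ℕ, (if x < k then (k : ℝ) ^ (-q) else 0) ≤ G k - G (k + 1) := by
    intro k
    rw [hG]
    dsimp only
    rw [← mul_sub]
    split_ifs with h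
    · have hk : (1 : ℝ) ≤ k := by
        have : (0 : ℝ) < k := hx.trans h
        exact_mod_cast this
      rw [max_eq_right h.le, max_eq_right (by push_cast; linarith)]
      push_cast
      exact rpow_neg_le_sub_rpow hq hk
    · refine mul_nonneg (by positivity) (sub_nonneg.2 ?_)
      refine Real.rpow_le_rpow_of_nonpos (lt_max_of_lt_left hx) ?_ (by linarith)
      gcongr
      omega
  have hsum : ∀ N : ℕ, ∑ k ∈ Finset.range N, (if x < (k : ℝ) then (k : ℝ) ^ (-q) else 0)
      ≤ 2 ^ q / (q - 1) * x ^ (1 - q) := by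
    intro N
    refine (Finset.sum_le_sum fun k _ => hstep k).trans ?_
    rw [Finset.sum_range_sub']
    have hN : 0 ≤ G N := by simp only [hG]; positivity
    have hG0 : G 0 = 2 ^ q / (q - 1) * x ^ (1 - q) := by simp [hG, max_eq_left hx.le]
    linarith
  exact ⟨summable_of_sum_range_le h0 hsum, Real.tsum_le_of_sum_range_le h0 hsum⟩

theorem summable_max_one_rpow_neg {p : ℝ} (hp : 1 < p) :
    Summable fun j : ℕ => ((max 1 j : ℕ) : ℝ) ^ (-p) := by
  refine (summable_nat_add_iff 1).1 ?_
  have h := (summable_nat_add_iff 1).2 (Real.summable_nat_rpow.2 (show -p < -1 by linarith))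
  simpa using h

/-- Tail sums of `k^{-q₁} max(1,j)^{-q₂}` outside the hyperbolic cross
`k max(1,j)^γ ≤ x` decay like `x^{1-q₁}`. -/
theorem exists_tsum_rpow_compl_hyperbolicCross_le {q₁ q₂ γ : ℝ} (hq₁ : 1 < q₁)
    (hq₂ : 1 < q₂ - γ * (q₁ - 1)) :
    ∃ C : ℝ, 0 < C ∧ ∀ x : ℝ, 0 < x →
      Summable (fun q : ℕ × ℕ => if x < q.1 * ((max 1 q.2 : ℕ) : ℝ) ^ γ then
        (q.1 : ℝ) ^ (-q₁) * ((max 1 q.2 : ℕ) : ℝ) ^ (-q₂) else 0) ∧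
      ∑' q : ℕ × ℕ, (if x < q.1 * ((max 1 q.2 : ℕ) : ℝ) ^ γ then
        (q.1 : ℝ) ^ (-q₁) * ((max 1 q.2 : ℕ) : ℝ) ^ (-q₂) else 0) ≤ C * x ^ (1 - q₁) := by
  have hc : 0 < q₁ - 1 := by linarith
  have hJ : ∀ j : ℕ, (0 : ℝ) < ((max 1 j : ℕ) : ℝ) := fun j => by positivity
  have hS := summable_max_one_rpow_neg hq₂
  set Z := ∑' j : ℕ, ((max 1 j : ℕ) : ℝ) ^ (-(q₂ - γ * (q₁ - 1))) with hZ
  have hZpos : 0 < Z := hS.tsum_pos (fun j => (Real.rpow_pos_of_pos (hJ j) _).le) 0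
    (Real.rpow_pos_of_pos (hJ 0) _)
  refine ⟨2 ^ q₁ / (q₁ - 1) * Z, by positivity, fun x hx => ?_⟩
  set f : ℕ × ℕ → ℝ := fun q => if x < q.1 * ((max 1 q.2 : ℕ) : ℝ) ^ γ then
        (q.1 : ℝ) ^ (-q₁) * ((max 1 q.2 : ℕ) : ℝ) ^ (-q₂) else 0 with hf
  set g : ℕ × ℕ → ℝ := fun q => f q.swap with hg
  have hrow : ∀ j k : ℕ, g (j, k) = ((max 1 j : ℕ) : ℝ) ^ (-q₂) *
      (if x / ((max 1 j : ℕ) : ℝ) ^ γ < k then (k : ℝ) ^ (-q₁) else 0) := by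
    intro j k
    simp only [hg, hf, Prod.swap_prod_mk, div_lt_iff₀ (Real.rpow_pos_of_pos (hJ j) γ)]
    split_ifs
    · ring
    · simp
  have hg0 : 0 ≤ g := by
    rintro ⟨j, k⟩
    rw [hrow]
    simp only [Pi.zero_apply]
    positivity
  have hrows : ∀ j : ℕ, Summable fun k => g (j, k) := by
    intro j
    simp only [hrow]
    exact (summable_and_tsum_rpow_tail_le hq₁
      (div_pos hx (Real.rpow_pos_of_pos (hJ j) γ))).1.mul_left _
  have hrow_le : ∀ j : ℕ, ∑' k, g (j, k) ≤ 2 ^ q₁ / (q₁ - 1) * x ^ (1 - q₁) *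
      ((max 1 j : ℕ) : ℝ) ^ (-(q₂ - γ * (q₁ - 1))) := by
    intro j
    simp only [hrow]
    rw [tsum_mul_left]
    have hp := Real.rpow_pos_of_pos (hJ j) γ
    refine (mul_le_mul_of_nonneg_left (summable_and_tsum_rpow_tail_le hq₁ (div_pos hx hp)).2
      (Real.rpow_nonneg (hJ j).le _)).trans_eq ?_
    rw [Real.div_rpow hx.le hp.le, ← Real.rpow_mul (hJ j).le, div_eq_mul_inv (x ^ (1 - q₁)),
      ← Real.rpow_neg (hJ j).le,
      show -(q₂ - γ * (q₁ - 1)) = -q₂ + -(γ * (1 - q₁)) by ring, Real.rpow_add (hJ j)]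
    ring
  have hmaj := hS.mul_left (2 ^ q₁ / (q₁ - 1) * x ^ (1 - q₁))
  have hcol : Summable fun j : ℕ => ∑' k, g (j, k) :=
    hmaj.of_nonneg_of_le (fun j => tsum_nonneg fun k => hg0 (j, k)) hrow_le
  have hgS : Summable g := (summable_prod_of_nonneg hg0).2 ⟨hrows, hcol⟩
  have hfS : Summable f := (Equiv.prodComm ℕ ℕ).summable_iff.1 hgS
  refine ⟨hfS, ?_⟩
  calc ∑' q, f q = ∑' q, g q := ((Equiv.prodComm ℕ ℕ).tsum_eq f).symm
    _ = ∑' j, ∑' k, g (j, k) := hgS.tsum_prod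
    _ ≤ ∑' j : ℕ, 2 ^ q₁ / (q₁ - 1) * x ^ (1 - q₁) *
        ((max 1 j : ℕ) : ℝ) ^ (-(q₂ - γ * (q₁ - 1))) := hcol.tsum_le_tsum hrow_le hmaj
    _ = 2 ^ q₁ / (q₁ - 1) * Z * x ^ (1 - q₁) := by rw [tsum_mul_left]; ring

/-- Hölder's inequality against the weight `k^{-A} max(1,j)^{-B}` outside the hyperbolic cross
`k max(1,j)^γ ≤ x`. -/
theorem exists_tsum_mul_compl_hyperbolicCross_le {s A B γ : ℝ} (hs : 1 ≤ s)
    (hA : 1 - 1 / s < A) (hγ : γ * (A - (1 - 1 / s)) < B - (1 - 1 / s)) :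
    ∃ C : ℝ, 0 < C ∧ ∀ u : ℕ × ℕ → ℝ, (∀ q, 0 ≤ u q) → Summable (fun q => u q ^ s) →
      ∀ x : ℝ, 0 < x →
      Summable (fun q : ℕ × ℕ => u q * if x < q.1 * ((max 1 q.2 : ℕ) : ℝ) ^ γ then
        (q.1 : ℝ) ^ (-A) * ((max 1 q.2 : ℕ) : ℝ) ^ (-B) else 0) ∧
      ∑' q : ℕ × ℕ, (u q * if x < q.1 * ((max 1 q.2 : ℕ) : ℝ) ^ γ then
        (q.1 : ℝ) ^ (-A) * ((max 1 q.2 : ℕ) : ℝ) ^ (-B) else 0)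
          ≤ C * (∑' q, u q ^ s) ^ (1 / s) * x ^ (1 - 1 / s - A) := by
  have hJ : ∀ j : ℕ, (1 : ℝ) ≤ ((max 1 j : ℕ) : ℝ) := fun j => by simp
  have hJ0 : ∀ j : ℕ, (0 : ℝ) < ((max 1 j : ℕ) : ℝ) := fun j => by positivity
  rcases hs.eq_or_lt with rfl | hs1
  · refine ⟨1, one_pos, fun u hu hus x hx => ?_⟩
    norm_num at hA hγ
    simp only [Real.rpow_one] at hus
    have hle : ∀ q : ℕ × ℕ, (u q * if x < q.1 * ((max 1 q.2 : ℕ) : ℝ) ^ γ then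
        (q.1 : ℝ) ^ (-A) * ((max 1 q.2 : ℕ) : ℝ) ^ (-B) else 0) ≤ x ^ (-A) * u q := by
      intro q
      rw [mul_comm]
      refine mul_le_mul_of_nonneg_right ?_ (hu q)
      split_ifs with h
      · calc (q.1 : ℝ) ^ (-A) * ((max 1 q.2 : ℕ) : ℝ) ^ (-B)
            ≤ (q.1 : ℝ) ^ (-A) * ((max 1 q.2 : ℕ) : ℝ) ^ (γ * -A) := by
              gcongr
              · exact hJ q.2
              · linarith
          _ = (q.1 * ((max 1 q.2 : ℕ) : ℝ) ^ γ) ^ (-A) := by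
              rw [Real.mul_rpow (by positivity) (by positivity), ← Real.rpow_mul (hJ0 _).le]
          _ ≤ x ^ (-A) := Real.rpow_le_rpow_of_nonpos hx h.le (by linarith)
      · positivity
    have hmaj := hus.mul_left (x ^ (-A))
    have hsum := hmaj.of_nonneg_of_le (fun q => mul_nonneg (hu q) (by positivity)) hle
    refine ⟨hsum, (hsum.tsum_le_tsum hle hmaj).trans_eq ?_⟩
    rw [tsum_mul_left]
    norm_num
    ring
  · set p := s / (s - 1) with hp
    have hs0 : 0 < s := by linarith
    have hsp : s.HolderConjugate p := Real.HolderConjugate.conjExponent hs1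
    have hp0 : 0 < p := hsp.symm.pos
    have hpinv : 1 - 1 / s = p⁻¹ := by
      rw [hp]
      have : s - 1 ≠ 0 := by linarith
      field_simp
    rw [hpinv] at hA hγ ⊢
    have hpi : p⁻¹ * p = 1 := inv_mul_cancel₀ hp0.ne'
    obtain ⟨C, hC, hbound⟩ := exists_tsum_rpow_compl_hyperbolicCross_le (q₁ := A * p)
      (q₂ := B * p) (γ := γ) (by nlinarith) (by
        have h := mul_lt_mul_of_pos_right hγ hp0
        rw [sub_mul, mul_assoc, sub_mul, hpi] at h
        linarith)
    refine ⟨C ^ (1 / p), by positivity, fun u hu hus x hx => ?_⟩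
    obtain ⟨hbs, hble⟩ := hbound x hx
    have hpow : ∀ q : ℕ × ℕ, (if x < q.1 * ((max 1 q.2 : ℕ) : ℝ) ^ γ then
        (q.1 : ℝ) ^ (-A) * ((max 1 q.2 : ℕ) : ℝ) ^ (-B) else 0) ^ p
        = if x < q.1 * ((max 1 q.2 : ℕ) : ℝ) ^ γ then
        (q.1 : ℝ) ^ (-(A * p)) * ((max 1 q.2 : ℕ) : ℝ) ^ (-(B * p)) else 0 := by
      intro q
      split_ifs
      · rw [Real.mul_rpow (by positivity) (by positivity), ← Real.rpow_mul (by positivity),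
          ← Real.rpow_mul (by positivity), neg_mul, neg_mul]
      · exact Real.zero_rpow hp0.ne'
    have hh := Real.summable_and_inner_le_Lp_mul_Lq_tsum_of_nonneg hsp hu
      (g := fun q : ℕ × ℕ => if x < q.1 * ((max 1 q.2 : ℕ) : ℝ) ^ γ then
        (q.1 : ℝ) ^ (-A) * ((max 1 q.2 : ℕ) : ℝ) ^ (-B) else 0)
      (fun q => by positivity) hus (by simpa only [hpow] using hbs)
    refine ⟨hh.1, hh.2.trans ?_⟩
    simp only [hpow]
    calc _ ≤ (∑' q, u q ^ s) ^ (1 / s) * (C * x ^ (1 - A * p)) ^ (1 / p) := by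
          gcongr
          · exact Real.rpow_nonneg (tsum_nonneg fun q => Real.rpow_nonneg (hu q) _) _
      _ = _ := by
          rw [Real.mul_rpow hC.le (by positivity), ← Real.rpow_mul hx.le,
            show (1 - A * p) * (1 / p) = p⁻¹ - A by field_simp]
          ring

theorem sqrt_natCast_add_half_le (k : ℕ) :
    Real.sqrt ((k : ℝ) + 1 / 2) ≤ 2 * ((max 1 k : ℕ) : ℝ) ^ (1 / 2 : ℝ) := by
  rw [← Real.sqrt_eq_rpow, Real.sqrt_le_left (by positivity), mul_pow,
    Real.sq_sqrt (by positivity)]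
  have h1 : (1 : ℝ) ≤ ((max 1 k : ℕ) : ℝ) := by simp
  have h2 : (k : ℝ) ≤ ((max 1 k : ℕ) : ℝ) := by simp
  linarith

theorem abs_legP_le (j : ℕ) {τ : ℝ} (hτ : τ ∈ Set.Icc (-1 : ℝ) 1) :
    |legP j τ| ≤ 2 * ((max 1 j : ℕ) : ℝ) ^ (1 / 2 : ℝ) := by
  have h := abs_iteratedDeriv_legP_le 0 j hτ
  rw [iteratedDeriv_zero, mul_zero, pow_zero, mul_one] at h
  exact h.trans (sqrt_natCast_add_half_le j)

theorem abs_Fderiv_term_le {s : ℝ} (hs : 1 ≤ s) (μ₁ μ₂ : ℝ) (r : ℕ) (a : ℕ → ℕ → ℝ)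
    {t τ : ℝ} (ht : t ∈ Set.Icc (-1 : ℝ) 1) (hτ : τ ∈ Set.Icc (-1 : ℝ) 1)
    {q : ℕ × ℕ} (hq : 1 ≤ q.1) :
    |a q.1 q.2 * iteratedDeriv r (legP q.1) t * legP q.2 τ| ≤
      4 * (wTerm s μ₁ μ₂ a q ^ (1 / s) * ((q.1 : ℝ) ^ (-(μ₁ - 2 * (r : ℝ) - 1 / 2)) *
        ((max 1 q.2 : ℕ) : ℝ) ^ (-(μ₂ - 1 / 2)))) := by
  obtain ⟨k, j⟩ := q
  dsimp only at hq ⊢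
  have hs0 : s ≠ 0 := by linarith
  have hk : (0 : ℝ) < k := by exact_mod_cast hq
  have hJ : (0 : ℝ) < ((max 1 j : ℕ) : ℝ) := by positivity
  have h1 : |iteratedDeriv r (legP k) t| ≤ 2 * (k : ℝ) ^ (1 / 2 : ℝ) * (k : ℝ) ^ (2 * r) := by
    refine (abs_iteratedDeriv_legP_le r k ht).trans ?_
    gcongr
    simpa only [max_eq_right hq] using sqrt_natCast_add_half_le k
  have h2 := abs_legP_le j hτ
  have hw : wTerm s μ₁ μ₂ a (k, j) ^ (1 / s)
      = (k : ℝ) ^ μ₁ * ((max 1 j : ℕ) : ℝ) ^ μ₂ * |a k j| := by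
    simp only [wTerm, max_eq_right hq]
    rw [Real.mul_rpow (by positivity) (by positivity),
      Real.mul_rpow (by positivity) (by positivity),
      ← Real.rpow_mul hk.le, ← Real.rpow_mul hJ.le, ← Real.rpow_mul (abs_nonneg _),
      mul_one_div_cancel hs0, Real.rpow_one, show s * μ₁ * (1 / s) = μ₁ by field_simp,
      show s * μ₂ * (1 / s) = μ₂ by field_simp]
  rw [abs_mul, abs_mul, hw]
  calc |a k j| * |iteratedDeriv r (legP k) t| * |legP j τ|
      ≤ |a k j| * (2 * (k : ℝ) ^ (1 / 2 : ℝ) * (k : ℝ) ^ (2 * r)) *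
        (2 * ((max 1 j : ℕ) : ℝ) ^ (1 / 2 : ℝ)) := by gcongr
    _ = 4 * |a k j| * ((k : ℝ) ^ (1 / 2 : ℝ) * (k : ℝ) ^ (2 * (r : ℝ))) *
        ((max 1 j : ℕ) : ℝ) ^ (1 / 2 : ℝ) := by
        rw [show (2 : ℝ) * r = ((2 * r : ℕ) : ℝ) by push_cast; ring, Real.rpow_natCast]; ring
    _ = 4 * |a k j| * ((k : ℝ) ^ μ₁ * (k : ℝ) ^ (-(μ₁ - 2 * (r : ℝ) - 1 / 2))) *
        (((max 1 j : ℕ) : ℝ) ^ μ₂ * ((max 1 j : ℕ) : ℝ) ^ (-(μ₂ - 1 / 2))) := by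
        simp only [← Real.rpow_add hk, ← Real.rpow_add hJ]
        ring_nf
    _ = _ := by ring

theorem Dtrunc_eq_tsum {r : ℕ} (hr : 1 ≤ r) (n : ℕ) {γ : ℝ} (hγ : 1 ≤ γ) (a : ℕ → ℕ → ℝ)
    (t τ : ℝ) :
    Dtrunc r n γ a t τ = ∑' q : ℕ × ℕ, if (n : ℝ) < q.1 * ((max 1 q.2 : ℕ) : ℝ) ^ γ then 0 else
      a q.1 q.2 * iteratedDeriv r (legP q.1) t * legP q.2 τ := by
  have hJ : ∀ j : ℕ, ((max 1 j : ℕ) : ℝ) ≤ ((max 1 j : ℕ) : ℝ) ^ γ := fun j =>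
    Real.self_le_rpow_of_one_le (by simp) hγ
  rw [tsum_eq_sum (s := Finset.Icc r n ×ˢ Finset.range (n + 1)), Finset.sum_product, Dtrunc]
  · refine Finset.sum_congr rfl fun k hk => Finset.sum_congr rfl fun j _ => ?_
    rw [Finset.mem_Icc] at hk
    have hkn : (k : ℝ) ≤ n := by exact_mod_cast hk.2
    rcases Nat.eq_zero_or_pos j with rfl | hj
    · have hγ0 : γ ≠ 0 := by linarith
      simp [Real.zero_rpow hγ0, hkn.not_gt]
    · simp only [max_eq_right (Nat.succ_le_of_lt hj), ← not_le, ite_not]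
  · rintro ⟨k, j⟩ hq
    dsimp only
    rcases lt_or_ge k r with hkr | hkr
    · simp [iteratedDeriv_legP_of_lt hkr]
    · refine if_pos ?_
      have hk1 : (1 : ℝ) ≤ k := by exact_mod_cast hr.trans hkr
      have hJ1 : (1 : ℝ) ≤ ((max 1 j : ℕ) : ℝ) := by simp
      have hJj : (j : ℝ) ≤ ((max 1 j : ℕ) : ℝ) := by simp
      have hJγ := hJ j
      simp only [Finset.mem_product, Finset.mem_Icc, Finset.mem_range, not_and_or] at hq
      rcases hq with (h | h) | h
      · exact absurd hkr h
      · have : (n : ℝ) < k := by exact_mod_cast not_le.1 h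
        nlinarith
      · have : (n : ℝ) < j := by exact_mod_cast (by omega : n < j)
        nlinarith

/-- Lemma 4: for `f ∈ L_{s,2}^{μ̄}`, `1 ≤ s < ∞`, `μ₁ > 2r - 1/s + 3/2`,
`μ₂ > μ₁ - 2r`, `1 ≤ γ < (μ₂+1/s-3/2)/(μ₁-2r+1/s-3/2)`:
`‖f^{(r,0)} - D_{n,γ}^{(r,0)} f‖_C ≤ c ‖f‖_{s,μ̄} n^{-μ₁+2r-1/s+3/2}` (sup-norm on `[-1,1]²`). -/
theorem truncation_error_C (r : ℕ) (hr : 1 ≤ r) (s μ₁ μ₂ γ : ℝ) (hs : 1 ≤ s)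
    (hμ₁ : 2 * (r : ℝ) - 1 / s + 3 / 2 < μ₁) (hμ₂ : μ₁ - 2 * (r : ℝ) < μ₂)
    (hγ1 : 1 ≤ γ)
    (hγ2 : γ < (μ₂ + 1 / s - 3 / 2) / (μ₁ - 2 * (r : ℝ) + 1 / s - 3 / 2)) :
    ∃ c > 0, ∀ a : ℕ → ℕ → ℝ, Summable (wTerm s μ₁ μ₂ a) → ∀ n : ℕ, 1 ≤ n →
      ∀ t ∈ Set.Icc (-1 : ℝ) 1, ∀ τ ∈ Set.Icc (-1 : ℝ) 1,
        |Fderiv r a t τ - Dtrunc r n γ a t τ| ≤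
          c * wNorm s μ₁ μ₂ a * (n : ℝ) ^ (-μ₁ + 2 * (r : ℝ) - 1 / s + 3 / 2) := by
  have hs0 : 0 < s := by linarith
  have hden : 0 < μ₁ - 2 * (r : ℝ) + 1 / s - 3 / 2 := by linarith
  rw [lt_div_iff₀ hden] at hγ2
  obtain ⟨C, hC, hmain⟩ := exists_tsum_mul_compl_hyperbolicCross_le (s := s)
    (A := μ₁ - 2 * (r : ℝ) - 1 / 2) (B := μ₂ - 1 / 2) (γ := γ) hs (by linarith)
    (by linarith)
  refine ⟨4 * C, by positivity, fun a ha n hn t ht τ hτ => ?_⟩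
  have hw0 : ∀ q, 0 ≤ wTerm s μ₁ μ₂ a q := fun q => by unfold wTerm; positivity
  have hws : ∀ q, (wTerm s μ₁ μ₂ a q ^ (1 / s)) ^ s = wTerm s μ₁ μ₂ a q := fun q => by
    rw [← Real.rpow_mul (hw0 q), one_div_mul_cancel hs0.ne', Real.rpow_one]
  have hmain := hmain (fun q => wTerm s μ₁ μ₂ a q ^ (1 / s))
    (fun q => Real.rpow_nonneg (hw0 q) _) (by simpa only [hws] using ha)
  simp only [hws] at hmain
  set T : ℕ × ℕ → ℝ := fun q => a q.1 q.2 * iteratedDeriv r (legP q.1) t * legP q.2 τ with hT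
  have hTS : Summable T := by
    refine Summable.of_norm_bounded ((hmain (1 / 2) (by norm_num)).1.mul_left 4) fun q => ?_
    rw [Real.norm_eq_abs]
    rcases Nat.eq_zero_or_pos q.1 with h | h
    · have : T q = 0 := by simp [hT, iteratedDeriv_legP_of_lt (show q.1 < r by omega)]
      rw [this, abs_zero]
      have := hw0 q
      positivity
    · rw [if_pos]
      · exact abs_Fderiv_term_le hs μ₁ μ₂ r a ht hτ h
      · have h1 : (1 : ℝ) ≤ q.1 := by exact_mod_cast h
        have h2 : (1 : ℝ) ≤ ((max 1 q.2 : ℕ) : ℝ) ^ γ :=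
          Real.one_le_rpow (by simp) (by linarith)
        nlinarith
  have hn0 : (0 : ℝ) < n := by exact_mod_cast hn
  obtain ⟨hbS, hble⟩ := hmain n hn0
  have hsub : Fderiv r a t τ - Dtrunc r n γ a t τ
      = ∑' q : ℕ × ℕ, if (n : ℝ) < q.1 * ((max 1 q.2 : ℕ) : ℝ) ^ γ then T q else 0 := by
    have hind := hTS.indicator {q : ℕ × ℕ | ¬ (n : ℝ) < q.1 * ((max 1 q.2 : ℕ) : ℝ) ^ γ}
    have hcut : Summable fun q : ℕ × ℕ =>
        if (n : ℝ) < q.1 * ((max 1 q.2 : ℕ) : ℝ) ^ γ then 0 else T q :=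
      hind.congr fun q => by simp [Set.indicator_apply, ite_not, -not_lt]
    rw [Dtrunc_eq_tsum hr n hγ1, Fderiv, ← hTS.tsum_sub hcut]
    refine tsum_congr fun q => ?_
    split_ifs <;> simp
  have hterm : ∀ q : ℕ × ℕ,
      ‖if (n : ℝ) < q.1 * ((max 1 q.2 : ℕ) : ℝ) ^ γ then T q else 0‖ ≤
        4 * (wTerm s μ₁ μ₂ a q ^ (1 / s) *
          if (n : ℝ) < q.1 * ((max 1 q.2 : ℕ) : ℝ) ^ γ then
            (q.1 : ℝ) ^ (-(μ₁ - 2 * (r : ℝ) - 1 / 2)) *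
              ((max 1 q.2 : ℕ) : ℝ) ^ (-(μ₂ - 1 / 2)) else 0) := by
    intro q
    split_ifs with h
    · refine abs_Fderiv_term_le hs μ₁ μ₂ r a ht hτ (Nat.one_le_iff_ne_zero.2 fun h0 => ?_)
      rw [h0, Nat.cast_zero, zero_mul] at h
      exact lt_asymm h hn0
    · simp
  rw [hsub, ← Real.norm_eq_abs]
  refine (tsum_of_norm_bounded (hbS.mul_left 4).hasSum hterm).trans ?_
  rw [tsum_mul_left, wNorm]
  calc _ ≤ 4 * (C * (∑' q, wTerm s μ₁ μ₂ a q) ^ (1 / s) *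
        (n : ℝ) ^ (1 - 1 / s - (μ₁ - 2 * (r : ℝ) - 1 / 2))) := by gcongr
    _ = _ := by
      rw [show 1 - 1 / s - (μ₁ - 2 * (r : ℝ) - 1 / 2)
        = -μ₁ + 2 * (r : ℝ) - 1 / s + 3 / 2 by ring]
      ring
end
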